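/- Adding a link: let i ∈ I and j ∈ N with (i,j) ∉ E and v_i ≤ v_j, and let Ẽ = E ∪ {(i,j)}. Then π̃^T e_I ≥ π^T e_I, with equality if and only if the node i does not have access to Ī (in the graph (N,E)). -/

import Mathlib

open Matrix Finset

/-- Outdegree of node `i` in the edge set `E`. -/
def outdeg {n : ℕ} (E : Finset (Fin n × Fin n)) (i : Fin n) : ℕ :=
  (Finset.univ.filter (fun j => (i, j) ∈ E)).card

/-- The scaled adjacency matrix `P` of the graph: `P i j = 1 / outdeg i` if `(i,j) ∈ E`. -/
noncomputable def Pmat {n : ℕ} (E : Finset (Fin n × Fin n)) : Matrix (Fin n) (Fin n) ℝ :=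
  fun i j => if (i, j) ∈ E then ((outdeg E i : ℝ))⁻¹ else 0

/-- Indicator vector of a set of nodes. -/
def ind {n : ℕ} (I : Finset (Fin n)) : Fin n → ℝ :=
  fun i => if i ∈ I then 1 else 0

/-- `v = (Id - cP)⁻¹ e_I`, the vector of mean numbers of visits to `I` before zapping. -/
noncomputable def vvec {n : ℕ} (c : ℝ) (E : Finset (Fin n × Fin n)) (I : Finset (Fin n)) : Fin n → ℝ :=
  (1 - c • Pmat E)⁻¹ *ᵥ ind I

/-- PageRank vector `πᵀ = (1-c) zᵀ (Id - cP)⁻¹`. -/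
noncomputable def pr {n : ℕ} (c : ℝ) (z : Fin n → ℝ) (E : Finset (Fin n × Fin n)) : Fin n → ℝ :=
  (1 - c) • (((1 - c • Pmat E)⁻¹)ᵀ *ᵥ z)

/-- PageRank of the set `I`: `πᵀ e_I`. -/
noncomputable def prSet {n : ℕ} (c : ℝ) (z : Fin n → ℝ) (E : Finset (Fin n × Fin n))
    (I : Finset (Fin n)) : ℝ :=
  ∑ i ∈ I, pr c z E i

/-- Node `i` has access to (some node of) the set `J`: `i ∈ J` or a directed path from `i`
reaches `J`. -/
def access {n : ℕ} (E : Finset (Fin n × Fin n)) (i : Fin n) (J : Finset (Fin n)) : Prop :=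
  ∃ j ∈ J, Relation.ReflTransGen (fun a b => (a, b) ∈ E) i j

theorem Pmat_nonneg' {n : ℕ} (E : Finset (Fin n × Fin n)) (a b : Fin n) : 0 ≤ Pmat E a b := by
  unfold Pmat
  split_ifs <;> positivity

theorem Pmat_mulVec' {n : ℕ} (E : Finset (Fin n × Fin n)) (x : Fin n → ℝ) (a : Fin n) :
    (Pmat E *ᵥ x) a = (outdeg E a : ℝ)⁻¹ * ∑ b ∈ univ.filter (fun b => (a, b) ∈ E), x b := by
  simp only [Matrix.mulVec, dotProduct, Pmat, ite_mul, zero_mul]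
  rw [← Finset.sum_filter, Finset.mul_sum]

theorem Pmat_const' {n : ℕ} (E : Finset (Fin n × Fin n)) (hE : ∀ i, 0 < outdeg E i)
    (a : Fin n) (m : ℝ) : (Pmat E *ᵥ (fun _ => m)) a = m := by
  rw [Pmat_mulVec']
  have h : (outdeg E a : ℝ) ≠ 0 := by exact_mod_cast (hE a).ne'
  rw [Finset.sum_const, nsmul_eq_mul]
  change (outdeg E a : ℝ)⁻¹ * ((outdeg E a : ℝ) * m) = m
  field_simp

theorem Pmat_mono' {n : ℕ} (E : Finset (Fin n × Fin n)) (x y : Fin n → ℝ) (h : ∀ b, x b ≤ y b)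
    (a : Fin n) : (Pmat E *ᵥ x) a ≤ (Pmat E *ᵥ y) a := by
  simp only [Matrix.mulVec, dotProduct]
  exact Finset.sum_le_sum fun b _ => mul_le_mul_of_nonneg_left (h b) (Pmat_nonneg' E a b)

theorem min_principle' {n : ℕ} (E : Finset (Fin n × Fin n)) (hE : ∀ i, 0 < outdeg E i)
    (c : ℝ) (hc0 : 0 < c) (hc1 : c < 1) (x : Fin n → ℝ)
    (hx : ∀ a, c * (Pmat E *ᵥ x) a ≤ x a) (a : Fin n) : 0 ≤ x a := by
  obtain ⟨k, -, hk⟩ := Finset.exists_min_image univ x ⟨a, mem_univ a⟩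
  have h1 : x k ≤ (Pmat E *ᵥ x) k := by
    have := Pmat_mono' E (fun _ => x k) x (fun b => hk b (mem_univ b)) k
    rwa [Pmat_const' E hE] at this
  have h2 := hx k
  have h3 := hk a (mem_univ a)
  have h4 : c * x k ≤ c * (Pmat E *ᵥ x) k := mul_le_mul_of_nonneg_left h1 hc0.le
  have : 0 ≤ x k := by nlinarith
  linarith

theorem isUnit_det' {n : ℕ} (E : Finset (Fin n × Fin n)) (hE : ∀ i, 0 < outdeg E i)
    (c : ℝ) (hc0 : 0 < c) (hc1 : c < 1) : IsUnit (1 - c • Pmat E).det := by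
  rw [← Matrix.isUnit_iff_isUnit_det, ← Matrix.mulVec_injective_iff_isUnit]
  have key : ∀ x : Fin n → ℝ, (1 - c • Pmat E) *ᵥ x = 0 → ∀ a, 0 ≤ x a := by
    intro x hx
    apply min_principle' E hE c hc0 hc1
    intro a
    have := congrFun hx a
    simp only [Matrix.sub_mulVec, Matrix.one_mulVec, Matrix.smul_mulVec, Pi.sub_apply,
      Pi.smul_apply, smul_eq_mul, Pi.zero_apply] at this
    linarith
  intro x y hxy
  have h1 : (1 - c • Pmat E) *ᵥ (x - y) = 0 := by
    rw [Matrix.mulVec_sub]; exact sub_eq_zero.2 hxy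
  have h2 : (1 - c • Pmat E) *ᵥ (y - x) = 0 := by
    rw [Matrix.mulVec_sub]; exact sub_eq_zero.2 hxy.symm
  funext a
  have e1 := key _ h1 a
  have e2 := key _ h2 a
  simp only [Pi.sub_apply] at e1 e2
  linarith

theorem vvec_eq' {n : ℕ} (E : Finset (Fin n × Fin n)) (hE : ∀ i, 0 < outdeg E i)
    (c : ℝ) (hc0 : 0 < c) (hc1 : c < 1) (I : Finset (Fin n)) (a : Fin n) :
    vvec c E I a = ind I a + c * (Pmat E *ᵥ vvec c E I) a := by
  have h : (1 - c • Pmat E) *ᵥ vvec c E I = ind I := by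
    unfold vvec
    rw [Matrix.mulVec_mulVec, Matrix.mul_nonsing_inv _ (isUnit_det' E hE c hc0 hc1),
      Matrix.one_mulVec]
  have := congrFun h a
  simp only [Matrix.sub_mulVec, Matrix.one_mulVec, Matrix.smul_mulVec, Pi.sub_apply,
      Pi.smul_apply, smul_eq_mul] at this
  linarith

theorem prSet_eq' {n : ℕ} (c : ℝ) (z : Fin n → ℝ) (E : Finset (Fin n × Fin n))
    (I : Finset (Fin n)) : prSet c z E I = (1 - c) * ∑ a, z a * vvec c E I a := by
  have h1 : prSet c z E I = pr c z E ⬝ᵥ ind I := by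
    simp [prSet, dotProduct, ind]
  have h2 : ∑ a, z a * vvec c E I a = z ⬝ᵥ vvec c E I := rfl
  rw [h1, h2, pr, vvec, smul_dotProduct, Matrix.mulVec_transpose, Matrix.dotProduct_mulVec,
    smul_eq_mul]

/-- `u = 1/(1-c) - v` is nonnegative and vanishes exactly at nodes without access to `Iᶜ`. -/
theorem u_facts' {n : ℕ} (E : Finset (Fin n × Fin n)) (hE : ∀ i, 0 < outdeg E i)
    (c : ℝ) (hc0 : 0 < c) (hc1 : c < 1) (I : Finset (Fin n)) :
    (∀ a, vvec c E I a ≤ (1 - c)⁻¹) ∧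
    (∀ a, vvec c E I a = (1 - c)⁻¹ ↔ ¬ access E a Iᶜ) := by
  set m := (1 - c)⁻¹ with hm
  have hm1 : m = 1 + c * m := by
    have : (1 - c) ≠ 0 := by linarith
    rw [hm]; field_simp; ring
  set u : Fin n → ℝ := (fun _ => m) - vvec c E I with hu
  have hua : ∀ a, u a = m - vvec c E I a := fun a => rfl
  have hueq : ∀ a, u a = (1 - ind I a) + c * (Pmat E *ᵥ u) a := by
    intro a
    rw [hua, hu, Matrix.mulVec_sub, Pi.sub_apply, Pmat_const' E hE, vvec_eq' E hE c hc0 hc1 I a]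
    linarith
  have hind : ∀ a, 0 ≤ 1 - ind I a := by
    intro a; unfold ind; split_ifs <;> norm_num
  have hu0 : ∀ a, 0 ≤ u a := by
    apply min_principle' E hE c hc0 hc1
    intro a
    have := hueq a
    have := hind a
    linarith
  refine ⟨fun a => by have := hu0 a; rw [hua] at this; linarith, fun a => ⟨?_, ?_⟩⟩
  · rintro h ⟨b, hb, hab⟩
    have hub : u b = 0 := by
      clear hb
      induction hab with
      | refl => rw [hua]; linarith
      | tail _ hxy ih =>
        rename_i x y _
        have h1 := hueq x
        have h2 := hind x
        have h3 : Pmat E x y * u y ≤ (Pmat E *ᵥ u) x :=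
          Finset.single_le_sum (f := fun b => Pmat E x b * u b)
            (fun b _ => mul_nonneg (Pmat_nonneg' E x b) (hu0 b)) (mem_univ y)
        have h4 : 0 < Pmat E x y := by
          have : (0:ℝ) < outdeg E x := by exact_mod_cast hE x
          simp only [Pmat, if_pos hxy]; positivity
        have h5 := hu0 y
        by_contra hne
        have h6 : 0 < Pmat E x y * u y := mul_pos h4 (lt_of_le_of_ne h5 (Ne.symm hne))
        have h7 : 0 < c * (Pmat E *ᵥ u) x := mul_pos hc0 (by linarith)
        linarith
    have h1 := hueq b
    have h2 : 0 ≤ (Pmat E *ᵥ u) b :=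
      Finset.sum_nonneg (s := univ) fun k _ => mul_nonneg (Pmat_nonneg' E b k) (hu0 k)
    have h3 : ind I b = 0 := by simp [ind, Finset.mem_compl.1 hb]
    have := mul_nonneg hc0.le h2
    linarith
  · intro h
    classical
    let x : Fin n → ℝ := fun a => if access E a Iᶜ then 0 else - u a
    have hx0 : ∀ b, x b ≤ 0 := by
      intro b
      by_cases hb : access E b Iᶜ
      · simp [x, hb]
      · simp [x, hb, hu0 b]
    have hx : ∀ a, 0 ≤ x a := by
      apply min_principle' E hE c hc0 hc1
      intro b
      by_cases hb : access E b Iᶜ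
      · have h1 := Pmat_mono' E x (fun _ => 0) hx0 b
        rw [Pmat_const' E hE] at h1
        have : x b = 0 := by simp [x, hb]
        nlinarith
      · have hxb : x b = - u b := by simp [x, hb]
        have hbI : b ∈ I := by
          by_contra hbI
          exact hb ⟨b, Finset.mem_compl.2 hbI, .refl⟩
        have hi : ind I b = 1 := by simp [ind, hbI]
        have hP : (Pmat E *ᵥ x) b = - (Pmat E *ᵥ u) b := by
          rw [Pmat_mulVec', Pmat_mulVec', ← mul_neg, ← Finset.sum_neg_distrib]
          congr 1
          apply Finset.sum_congr rfl
          intro k hk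
          have hk' : ¬ access E k Iᶜ := by
            rintro ⟨l, hl, hkl⟩
            exact hb ⟨l, hl, .head (Finset.mem_filter.1 hk).2 hkl⟩
          simp [x, hk']
        rw [hP, hxb, hueq b, hi]
        linarith
    have h1 := hx a
    have h2 : x a = - u a := by simp [x, h]
    have h3 := hu0 a
    rw [h2] at h1
    have := hua a
    linarith

/-- Proposition 6 (Adding a link): for `i ∈ I` and `j` with `(i,j) ∉ E` and `v i ≤ v j`,
adding the link `(i,j)` does not decrease the PageRank of `I`, with equality if and only
if `i` does not have access to the complement of `I`. -/
theorem stmt7 {n : ℕ} (hn : 1 ≤ n) (E : Finset (Fin n × Fin n))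
    (hE : ∀ i, 0 < outdeg E i) (c : ℝ) (hc0 : 0 < c) (hc1 : c < 1)
    (z : Fin n → ℝ) (hz : ∀ i, 0 < z i) (hz1 : ∑ i, z i = 1)
    (I : Finset (Fin n)) (i : Fin n) (hi : i ∈ I) (j : Fin n)
    (hij : (i, j) ∉ E) (hv : vvec c E I i ≤ vvec c E I j) :
    prSet c z E I ≤ prSet c z (insert (i, j) E) I ∧
    (prSet c z (insert (i, j) E) I = prSet c z E I ↔ ¬ access E i Iᶜ) := by
  obtain ⟨hle, heq⟩ := u_facts' E hE c hc0 hc1 I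
  set F := insert (i, j) E with hF
  set v := vvec c E I with hvdef
  set w := vvec c F I - v with hw
  have hother : ∀ a, a ≠ i → univ.filter (fun b => (a, b) ∈ F) = univ.filter (fun b => (a, b) ∈ E) := by
    intro a ha
    ext b
    simp [hF, ha]
  have hself : univ.filter (fun b => (i, b) ∈ F) = insert j (univ.filter (fun b => (i, b) ∈ E)) := by
    ext b
    simp [hF]
  have hnot : j ∉ univ.filter (fun b => (i, b) ∈ E) := by simp [hij]
  have hdi : outdeg F i = outdeg E i + 1 := by
    unfold outdeg
    rw [hself, Finset.card_insert_of_notMem hnot]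
  have hda : ∀ a, a ≠ i → outdeg F a = outdeg E a := by
    intro a ha
    unfold outdeg
    rw [hother a ha]
  have hFd : ∀ a, 0 < outdeg F a := by
    intro a
    by_cases ha : a = i
    · subst ha; omega
    · rw [hda a ha]; exact hE a
  have hPa : ∀ a, a ≠ i → (Pmat F *ᵥ v) a = (Pmat E *ᵥ v) a := by
    intro a ha
    rw [Pmat_mulVec', Pmat_mulVec', hother a ha, hda a ha]
  have hdpos : (0:ℝ) < outdeg E i := by exact_mod_cast hE i
  have hPi : ((outdeg E i : ℝ) + 1) * ((Pmat F *ᵥ v) i - (Pmat E *ᵥ v) i)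
      = v j - (Pmat E *ᵥ v) i := by
    rw [Pmat_mulVec', Pmat_mulVec', hself, hdi, Finset.sum_insert hnot]
    push_cast
    field_simp
    ring
  have hvi : v i = 1 + c * (Pmat E *ᵥ v) i := by
    have := vvec_eq' E hE c hc0 hc1 I i
    rwa [show ind I i = 1 by simp [ind, hi]] at this
  have hm : (1 - c)⁻¹ * (1 - c) = 1 := inv_mul_cancel₀ (by linarith)
  have hc' : 0 < 1 - c := by linarith
  -- the perturbation
  set δ := (Pmat F *ᵥ v) i - (Pmat E *ᵥ v) i with hδ
  have hweq : ∀ a, w a = c * (Pmat F *ᵥ w) a + c * ((Pmat F *ᵥ v) a - (Pmat E *ᵥ v) a) := by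
    intro a
    have h1 := vvec_eq' F hFd c hc0 hc1 I a
    have h2 := vvec_eq' E hE c hc0 hc1 I a
    rw [hw, Matrix.mulVec_sub, Pi.sub_apply, Pi.sub_apply, h1]
    rw [← hvdef] at h2
    linarith
  have hPv : c * (v i - (Pmat E *ᵥ v) i) = 1 - (1 - c) * v i := by linarith
  have hδ0 : 0 ≤ δ := by
    have h1 : (1 - c) * v i ≤ 1 := by nlinarith [hle i]
    have h2 : 0 ≤ v i - (Pmat E *ᵥ v) i := by
      by_contra hh
      nlinarith
    by_contra hh
    nlinarith
  have hpert : ∀ a, 0 ≤ (Pmat F *ᵥ v) a - (Pmat E *ᵥ v) a := by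
    intro a
    by_cases ha : a = i
    · subst ha; exact hδ0
    · rw [hPa a ha, sub_self]
  have hw0 : ∀ a, 0 ≤ w a := by
    apply min_principle' F hFd c hc0 hc1
    intro a
    have := hweq a
    have := mul_nonneg hc0.le (hpert a)
    linarith
  have hdiff : prSet c z F I = prSet c z E I + (1 - c) * ∑ a, z a * w a := by
    rw [prSet_eq', prSet_eq', ← mul_add, ← Finset.sum_add_distrib]
    congr 1
    apply Finset.sum_congr rfl
    intro a _
    rw [hw, Pi.sub_apply]
    ring
  have hsum0 : 0 ≤ ∑ a, z a * w a := Finset.sum_nonneg fun a _ => mul_nonneg (hz a).le (hw0 a)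
  refine ⟨by rw [hdiff]; nlinarith, ?_⟩
  rw [← heq i]
  constructor
  · intro h
    have hs : ∑ a, z a * w a = 0 := by
      have : (1 - c) * ∑ a, z a * w a = 0 := by linarith
      exact (mul_eq_zero.1 this).resolve_left hc'.ne'
    have hwi : w i = 0 := by
      have := (Finset.sum_eq_zero_iff_of_nonneg
        (fun a _ => mul_nonneg (hz a).le (hw0 a))).1 hs i (mem_univ i)
      exact (mul_eq_zero.1 this).resolve_left (hz i).ne'
    have h1 := hweq i
    have h2 : 0 ≤ (Pmat F *ᵥ w) i :=
      Finset.sum_nonneg (s := univ) fun k _ => mul_nonneg (Pmat_nonneg' F i k) (hw0 k)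
    have h3 := mul_nonneg hc0.le h2
    have h4 : δ = 0 := by
      have : c * δ ≤ 0 := by linarith
      nlinarith
    rw [h4, mul_zero] at hPi
    have h5 : c * (v i - (Pmat E *ᵥ v) i) ≤ 0 := by nlinarith
    have h6 : 1 ≤ (1 - c) * v i := by linarith
    apply le_antisymm (hle i)
    by_contra hh
    push Not at hh
    nlinarith
  · intro h
    have hj : v j = (1 - c)⁻¹ := le_antisymm (hle j) (by linarith)
    have h1 : c * (v i - (Pmat E *ᵥ v) i) = 0 := by rw [hPv, h]; linarith
    have h2 : v i - (Pmat E *ᵥ v) i = 0 := (mul_eq_zero.1 h1).resolve_left hc0.ne'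
    have h3 : δ = 0 := by
      have : ((outdeg E i : ℝ) + 1) * δ = 0 := by rw [hPi]; linarith
      exact (mul_eq_zero.1 this).resolve_left (by positivity)
    have hneg : ∀ a, 0 ≤ (-w) a := by
      apply min_principle' F hFd c hc0 hc1
      intro a
      rw [Matrix.mulVec_neg, Pi.neg_apply, Pi.neg_apply]
      have h4 := hweq a
      have h5 : (Pmat F *ᵥ v) a - (Pmat E *ᵥ v) a = 0 := by
        by_cases ha : a = i
        · subst ha; exact h3
        · rw [hPa a ha, sub_self]
      rw [h5] at h4
      linarith
    have hwz : ∀ a, w a = 0 := fun a => by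
      have h4 := hneg a
      rw [Pi.neg_apply] at h4
      linarith [hw0 a]
    rw [hdiff]
    simp [hwz]
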